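/- Let q be complex with |q| < 1 and a a complex number with a q^m != 1 for every integer m >= 1. Then sum_{j,k >= 0} a^{2j+k} q^{j(2j+2k+1) + k^2 + k} [k+j+1 choose j]_q / ((aq;q)_{2j+2k+1} (q;q)_k) = (aq;q)_inf^{-1} sum_{i >= 0} a^{2i} q^{C(2i+1,2)} / (q;q)_i, where [n+j choose j]_q = (q^{n+1};q)_j / (q;q)_j for integers j >= 0 and arbitrary integer n (so in particular [k+j+1 choose j]_q = (q^{k+2};q)_j/(q;q)_j). -/

import Mathlib

open scoped BigOperators

noncomputable section

/-- Finite q-Pochhammer symbol `(a;q)_n`. -/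
def qP (q a : ℂ) (n : ℕ) : ℂ := ∏ m ∈ Finset.range n, (1 - a * q ^ m)

/-- Infinite q-Pochhammer symbol `(a;q)_∞`. -/
def qPInf (q a : ℂ) : ℂ := ∏' m : ℕ, (1 - a * q ^ m)

/-- The q-binomial coefficient `[n+j choose j]_q = (q^{n+1};q)_j / (q;q)_j`
for `j : ℕ` and arbitrary `n : ℤ`. -/
def qBinTop (q : ℂ) (n : ℤ) (j : ℕ) : ℂ := qP q (q ^ (n + 1)) j / qP q q j

open Finset Filter Topology

lemma qP_succ (q a : ℂ) (n : ℕ) : qP q a (n + 1) = qP q a n * (1 - a * q ^ n) := by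
  simp [qP, Finset.prod_range_succ]

lemma qP_zero (q a : ℂ) : qP q a 0 = 1 := by simp [qP]

lemma qP_add (q a : ℂ) (m n : ℕ) : qP q a (m + n) = qP q a m * qP q (a * q ^ m) n := by
  simp only [qP, Finset.prod_range_add]
  congr 1
  refine Finset.prod_congr rfl fun i _ => ?_
  ring

lemma qP_ne (q b : ℂ) (hb : ∀ m : ℕ, b * q ^ m ≠ 1) (n : ℕ) : qP q b n ≠ 0 :=
  Finset.prod_ne_zero_iff.mpr fun m _ => sub_ne_zero.mpr (hb m).symm

lemma qq_ne (q : ℂ) (hq : ‖q‖ < 1) (m : ℕ) : q * q ^ m ≠ 1 := by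
  intro h
  have h1 : ‖q ^ (m + 1)‖ < 1 := by
    rw [norm_pow]; exact pow_lt_one₀ (norm_nonneg _) hq (by omega)
  rw [pow_succ', h] at h1
  simp at h1

lemma summ_aux (q b : ℂ) (hq : ‖q‖ < 1) : Summable fun m : ℕ => ‖-(b * q ^ m)‖ := by
  simp only [norm_neg, norm_mul, norm_pow]
  exact (summable_geometric_of_lt_one (norm_nonneg _) hq).mul_left _

lemma qP_tendsto (q b : ℂ) (hq : ‖q‖ < 1) :
    Tendsto (fun n => qP q b n) atTop (𝓝 (qPInf q b)) := by
  have h := (multipliable_one_add_of_summable (summ_aux q b hq)).hasProd.tendsto_prod_nat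
  simpa [qP, qPInf, sub_eq_add_neg] using h

lemma qPInf_ne (q b : ℂ) (hq : ‖q‖ < 1) (hb : ∀ m : ℕ, b * q ^ m ≠ 1) : qPInf q b ≠ 0 := by
  have h := tprod_one_add_ne_zero_of_summable (f := fun m : ℕ => -(b * q ^ m))
    (fun m => by simpa [← sub_eq_add_neg] using sub_ne_zero.mpr (hb m).symm) (summ_aux q b hq)
  simpa [qPInf, sub_eq_add_neg] using h

lemma tendsto_bdd (u : ℕ → ℂ) (l : ℂ) (h : Tendsto u atTop (𝓝 l)) :
    ∃ C : ℝ, 0 ≤ C ∧ ∀ n, ‖u n‖ ≤ C := by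
  obtain ⟨C, hC⟩ := h.norm.bddAbove_range
  have hC' : ∀ n, ‖u n‖ ≤ C := fun n => hC ⟨n, rfl⟩
  exact ⟨C, (norm_nonneg _).trans (hC' 0), hC'⟩

lemma qP_inv_bdd (q b : ℂ) (hq : ‖q‖ < 1) (hb : ∀ m : ℕ, b * q ^ m ≠ 1) :
    ∃ C : ℝ, 0 ≤ C ∧ ∀ n, ‖(qP q b n)⁻¹‖ ≤ C :=
  tendsto_bdd _ _ ((qP_tendsto q b hq).inv₀ (qPInf_ne q b hq hb))

lemma summ_sq (x y : ℝ) (hx : 0 ≤ x) (hy : 0 ≤ y) (hy1 : y < 1) :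
    Summable fun k : ℕ => x ^ k * y ^ (k ^ 2) := by
  have h : Tendsto (fun k : ℕ => x * y ^ k) atTop (𝓝 0) := by
    simpa using (tendsto_pow_atTop_nhds_zero_of_lt_one hy hy1).const_mul x
  have h2 : ∀ᶠ k : ℕ in atTop, x * y ^ k < 1 / 2 := h.eventually_lt_const (by norm_num)
  refine Summable.of_norm_bounded_eventually_nat (g := fun k : ℕ => (1 / 2 : ℝ) ^ k)
    (summable_geometric_of_lt_one (by norm_num) (by norm_num)) ?_
  filter_upwards [h2] with k hk
  have : x ^ k * y ^ (k ^ 2) = (x * y ^ k) ^ k := by rw [mul_pow, ← pow_mul, sq]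
  rw [this, Real.norm_of_nonneg (by positivity)]
  exact pow_le_pow_left₀ (by positivity) hk.le k

/-- The finite q-binomial theorem. -/
lemma q_binom (q : ℂ) (hq : ‖q‖ < 1) (x : ℂ) (n : ℕ) :
    ∑ p ∈ HasAntidiagonal.antidiagonal n, (-1) ^ p.1 * q ^ (p.1.choose 2) * x ^ p.1 / (qP q q p.1 * qP q q p.2)
      = qP q x n / qP q q n := by
  induction n with
  | zero => simp [qP_zero]
  | succ n ih =>
    have hne := qP_ne q q (qq_ne q hq)
    have hq1 : ∀ m, 1 - q * q ^ m ≠ 0 := fun m => sub_ne_zero.mpr (qq_ne q hq m).symm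
    set f : ℕ × ℕ → ℂ := fun p =>
      (-1) ^ p.1 * q ^ (p.1.choose 2) * x ^ p.1 / (qP q q p.1 * qP q q p.2) with hf
    have key : (1 - q * q ^ n) * ∑ p ∈ HasAntidiagonal.antidiagonal (n + 1), f p
        = (1 - x * q ^ n) * ∑ p ∈ HasAntidiagonal.antidiagonal n, f p := by
      have e1 : (1 - q * q ^ n) * ∑ p ∈ HasAntidiagonal.antidiagonal (n + 1), f p
          = ∑ p ∈ HasAntidiagonal.antidiagonal (n + 1), (1 - q ^ p.2) * f p
            + ∑ p ∈ HasAntidiagonal.antidiagonal (n + 1), q ^ p.2 * (1 - q ^ p.1) * f p := by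
        rw [Finset.mul_sum, ← Finset.sum_add_distrib]
        refine Finset.sum_congr rfl fun p hp => ?_
        have : q * q ^ n = q ^ p.1 * q ^ p.2 := by
          rw [← pow_add, HasAntidiagonal.mem_antidiagonal.mp hp, pow_succ']
        rw [this]; ring
      rw [e1, Finset.Nat.sum_antidiagonal_succ', Finset.Nat.sum_antidiagonal_succ]
      simp only [pow_zero, sub_self, zero_mul, mul_zero, zero_add]
      rw [sub_mul, one_mul, sub_eq_add_neg, Finset.mul_sum, ← Finset.sum_neg_distrib]
      congr 1
      · refine Finset.sum_congr rfl fun p _ => ?_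
        simp only [hf, qP_succ, pow_succ' q p.2]
        have := hne p.1
        have := hne p.2
        have := hq1 p.2
        field_simp
      · refine Finset.sum_congr rfl fun p hp => ?_
        simp only [hf, qP_succ, pow_succ' q p.1, Nat.choose_succ_succ' p.1 1, Nat.choose_one_right]
        rw [← HasAntidiagonal.mem_antidiagonal.mp hp]
        have := hne p.1
        have := hne p.2
        have := hq1 p.1
        field_simp
        ring
    rw [ih] at key
    have := hq1 n
    have := hne n
    rw [qP_succ, qP_succ]
    rw [eq_div_iff (by positivity)]
    field_simp at key
    linear_combination key

lemma antidiag_assoc (n : ℕ) (f : ℕ → ℕ → ℕ → ℂ) :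
    ∑ p ∈ HasAntidiagonal.antidiagonal n, ∑ s ∈ HasAntidiagonal.antidiagonal p.2, f p.1 s.1 s.2
      = ∑ p ∈ HasAntidiagonal.antidiagonal n, ∑ s ∈ HasAntidiagonal.antidiagonal p.1, f s.2 s.1 p.2 := by
  rw [Finset.sum_sigma', Finset.sum_sigma']
  refine Finset.sum_nbij' (fun x => ⟨(x.2.1 + x.1.1, x.2.2), (x.2.1, x.1.1)⟩)
    (fun x => ⟨(x.2.2, x.2.1 + x.1.2), (x.2.1, x.1.2)⟩) ?_ ?_ ?_ ?_ ?_
  · rintro ⟨⟨a, b⟩, ⟨c, d⟩⟩ h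
    simp only [mem_sigma, HasAntidiagonal.mem_antidiagonal] at h ⊢
    obtain ⟨h1, h2⟩ := h
    refine ⟨by omega, ?_⟩
    first | rfl | trivial | omega
  · rintro ⟨⟨a, b⟩, ⟨c, d⟩⟩ h
    simp only [mem_sigma, HasAntidiagonal.mem_antidiagonal] at h ⊢
    obtain ⟨h1, h2⟩ := h
    refine ⟨by omega, ?_⟩
    first | rfl | trivial | omega
  · rintro ⟨⟨a, b⟩, ⟨c, d⟩⟩ h
    simp only [mem_sigma, HasAntidiagonal.mem_antidiagonal] at h
    obtain ⟨h1, h2⟩ := h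
    subst h2
    rfl
  · rintro ⟨⟨a, b⟩, ⟨c, d⟩⟩ h
    simp only [mem_sigma, HasAntidiagonal.mem_antidiagonal] at h
    obtain ⟨h1, h2⟩ := h
    subst h2
    rfl
  · rintro ⟨⟨a, b⟩, ⟨c, d⟩⟩ h
    rfl

/-- The finite (Bailey pair) identity. -/
lemma bailey_fin (q : ℂ) (hq : ‖q‖ < 1) (a : ℂ) (s : ℕ) :
    ∑ p ∈ HasAntidiagonal.antidiagonal s, a ^ p.1 * q ^ (p.1 ^ 2) * qP q (q ^ (p.2 + 2)) p.1 /
        (qP q q p.1 * qP q q p.2)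
    = ∑ p ∈ HasAntidiagonal.antidiagonal s, a ^ p.1 * q ^ (p.1 ^ 2) * qP q (a * q ^ (s + p.1 + 2)) p.2 /
        (qP q q p.1 * qP q q p.2) := by
  set f : ℕ → ℕ → ℕ → ℂ := fun i r m => a ^ (i + r) * (-1) ^ r *
    q ^ (i ^ 2 + r.choose 2 + r * (2 * i + r + m + 2)) / (qP q q i * qP q q r * qP q q m) with hf
  have hR : ∑ p ∈ HasAntidiagonal.antidiagonal s, a ^ p.1 * q ^ (p.1 ^ 2) * qP q (a * q ^ (s + p.1 + 2)) p.2 /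
        (qP q q p.1 * qP q q p.2) =
      ∑ p ∈ HasAntidiagonal.antidiagonal s, ∑ t ∈ HasAntidiagonal.antidiagonal p.2, f p.1 t.1 t.2 := by
    refine Finset.sum_congr rfl fun p hp => ?_
    have := q_binom q hq (a * q ^ (s + p.1 + 2)) p.2
    rw [mul_div_mul_comm, ← this, Finset.mul_sum]
    refine Finset.sum_congr rfl fun t ht => ?_
    rw [HasAntidiagonal.mem_antidiagonal] at hp ht
    rw [← hp, ← ht]
    simp only [hf]
    rw [div_mul_div_comm, mul_assoc (qP q q p.1)]
    congr 1
    ring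
  have hL : ∑ p ∈ HasAntidiagonal.antidiagonal s, a ^ p.1 * q ^ (p.1 ^ 2) * qP q (q ^ (p.2 + 2)) p.1 /
        (qP q q p.1 * qP q q p.2) =
      ∑ p ∈ HasAntidiagonal.antidiagonal s, ∑ t ∈ HasAntidiagonal.antidiagonal p.1, f t.2 t.1 p.2 := by
    refine Finset.sum_congr rfl fun p hp => ?_
    have := q_binom q hq (q ^ (p.2 + 2)) p.1
    rw [mul_comm (qP q q p.1), mul_div_mul_comm, ← this, Finset.mul_sum]
    refine Finset.sum_congr rfl fun t ht => ?_
    rw [HasAntidiagonal.mem_antidiagonal] at hp ht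
    rw [← ht]
    simp only [hf]
    rw [div_mul_div_comm]
    congr 1
    · ring
    · ring
  rw [hL, hR, antidiag_assoc]

/-- Terms of Cauchy's sum. -/
def cau (q a : ℂ) (N r : ℕ) : ℂ :=
  a ^ r * q ^ (N * r + r ^ 2) / (qP q q r * qP q (a * q) (N + r))

lemma cau_bdd (q a : ℂ) (hq : ‖q‖ < 1) (hb : ∀ m : ℕ, a * q * q ^ m ≠ 1) :
    ∃ C : ℝ, 0 ≤ C ∧ ∀ N r, ‖cau q a N r‖ ≤ C * (‖a‖ ^ r * ‖q‖ ^ (r ^ 2)) := by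
  obtain ⟨C1, h1, hC1⟩ := qP_inv_bdd q q hq (qq_ne q hq)
  obtain ⟨C2, h2, hC2⟩ := qP_inv_bdd q (a * q) hq hb
  refine ⟨C1 * C2, by positivity, fun N r => ?_⟩
  have e : cau q a N r = (qP q q r)⁻¹ * (qP q (a * q) (N + r))⁻¹ * (a ^ r * q ^ (N * r + r ^ 2)) := by
    rw [cau, div_eq_mul_inv, mul_inv]; ring
  rw [e, norm_mul, norm_mul, norm_mul, norm_pow, norm_pow]
  have h3 : ‖q‖ ^ (N * r + r ^ 2) ≤ ‖q‖ ^ (r ^ 2) :=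
    pow_le_pow_of_le_one (norm_nonneg _) hq.le (by omega)
  gcongr
  · exact hC1 r
  · exact hC2 _

lemma cau_summable (q a : ℂ) (hq : ‖q‖ < 1) (hb : ∀ m : ℕ, a * q * q ^ m ≠ 1) (N : ℕ) :
    Summable (cau q a N) := by
  obtain ⟨C, h, hC⟩ := cau_bdd q a hq hb
  exact Summable.of_norm_bounded ((summ_sq ‖a‖ ‖q‖ (norm_nonneg _) (norm_nonneg _) hq).mul_left C)
    (hC N)

lemma cau_step (q a : ℂ) (hq : ‖q‖ < 1) (hb : ∀ m : ℕ, a * q * q ^ m ≠ 1) (N : ℕ) :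
    ∑' r, cau q a N r = ∑' r, cau q a (N + 1) r := by
  have hs := cau_summable q a hq hb N
  have hs1 := cau_summable q a hq hb (N + 1)
  set A : ℕ → ℂ := fun r => (1 - q ^ r) * cau q a N r with hA
  have hAs : Summable A := by
    refine Summable.of_norm_bounded (hs.norm.mul_left 2) fun r => ?_
    rw [hA, norm_mul]
    gcongr
    calc ‖1 - q ^ r‖ ≤ ‖(1 : ℂ)‖ + ‖q ^ r‖ := norm_sub_le _ _
      _ ≤ 1 + 1 := by
        rw [norm_one, norm_pow]
        gcongr
        exact pow_le_one₀ (norm_nonneg _) hq.le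
      _ = 2 := by norm_num
  have hAs1 : Summable fun r => A (r + 1) := (summable_nat_add_iff 1).mpr hAs
  have h0 : ∑' r, A r = ∑' r, A (r + 1) := by
    rw [hAs.tsum_eq_zero_add]; simp [hA]
  have hterm : ∀ r, cau q a N r - cau q a (N + 1) r = A r - A (r + 1) := by
    intro r
    have n1 := qP_ne q q (qq_ne q hq) r
    have n2 := qP_ne q (a * q) hb (N + r)
    have n3 : 1 - q * q ^ r ≠ 0 := sub_ne_zero.mpr (qq_ne q hq r).symm
    have n4 : 1 - a * q * q ^ (N + r) ≠ 0 := sub_ne_zero.mpr (hb (N + r)).symm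
    simp only [hA, cau]
    rw [show N + 1 + r = N + r + 1 by ring, show N + (r + 1) = N + r + 1 by ring, qP_succ, qP_succ,
      pow_succ' q r]
    field_simp
    ring
  have := hs.tsum_sub hs1
  rw [tsum_congr hterm, hAs.tsum_sub hAs1, h0, sub_self] at this
  exact (sub_eq_zero.mp this.symm)

lemma cau_sum (q a : ℂ) (hq : ‖q‖ < 1) (hb : ∀ m : ℕ, a * q * q ^ m ≠ 1) (N : ℕ) :
    ∑' r, cau q a N r = (qPInf q (a * q))⁻¹ := by
  have hconst : ∀ M, ∑' r, cau q a (N + M) r = ∑' r, cau q a N r := by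
    intro M
    induction M with
    | zero => rfl
    | succ M ih => rw [← ih, cau_step q a hq hb (N + M)]; rfl
  obtain ⟨C, h, hC⟩ := cau_bdd q a hq hb
  have hlim : Tendsto (fun M => ∑' r, cau q a M r) atTop
      (𝓝 (∑' r, if r = 0 then (qPInf q (a * q))⁻¹ else 0)) := by
    refine tendsto_tsum_of_dominated_convergence
      ((summ_sq ‖a‖ ‖q‖ (norm_nonneg _) (norm_nonneg _) hq).mul_left C) ?_
      (Eventually.of_forall fun M r => hC M r)
    intro r
    have hinv := (qP_tendsto q (a * q) hq).inv₀ (qPInf_ne q _ hq hb)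
    by_cases hr : r = 0
    · subst hr
      simpa [cau, qP_zero] using hinv
    · simp only [hr, if_false]
      have hq0 : Tendsto (fun M : ℕ => (q ^ r) ^ M) atTop (𝓝 0) := by
        apply tendsto_pow_atTop_nhds_zero_of_norm_lt_one
        rw [norm_pow]; exact pow_lt_one₀ (norm_nonneg _) hq hr
      have h3 := ((hinv.comp (tendsto_add_atTop_nat r)).mul hq0).const_mul
        (a ^ r * q ^ (r ^ 2) * (qP q q r)⁻¹)
      simp only [mul_zero] at h3
      refine h3.congr fun M => ?_
      simp only [cau, Function.comp, div_eq_mul_inv, mul_inv]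
      ring
  have h2 : Tendsto (fun M => ∑' r, cau q a (M + N) r) atTop (𝓝 (∑' r, cau q a N r)) := by
    refine tendsto_const_nhds.congr fun M => ?_
    rw [add_comm, hconst]
  have h3 := tendsto_nhds_unique h2 (hlim.comp (tendsto_add_atTop_nat N))
  rw [h3, tsum_ite_eq]

lemma tsum_antidiag (f : ℕ × ℕ → ℂ) (hf : Summable f) :
    ∑' x, f x = ∑' n, ∑ p ∈ HasAntidiagonal.antidiagonal n, f p := by
  conv_rhs => congr; ext; rw [← Finset.sum_finset_coe, ← tsum_fintype (L := .unconditional _)]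
  rw [← HasAntidiagonal.sigmaAntidiagonalEquivProd.tsum_eq f]
  exact (HasAntidiagonal.sigmaAntidiagonalEquivProd.summable_iff.mpr hf).tsum_sigma'
    (fun n ↦ (hasSum_fintype _).summable)

lemma bdd_mul (u v : ℕ × ℕ → ℂ) (C D : ℝ) (hu : ∀ x, ‖u x‖ ≤ C) (hv : ∀ x, ‖v x‖ ≤ D)
    (x : ℕ × ℕ) : ‖u x * v x‖ ≤ C * D := by
  rw [norm_mul]
  exact mul_le_mul (hu x) (hv x) (norm_nonneg _) ((norm_nonneg _).trans (hu x))

lemma summ_prod (q a : ℂ) (hq : ‖q‖ < 1) (f : ℕ × ℕ → ℂ) (g : ℕ × ℕ → ℂ) (C : ℝ)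
    (hC : ∀ x, ‖g x‖ ≤ C) (e : ℕ × ℕ → ℕ) (he : ∀ x, x.1 ^ 2 + x.2 ^ 2 ≤ e x)
    (hfg : ∀ x, f x = g x * (a ^ (2 * x.1 + x.2) * q ^ e x)) : Summable f := by
  have hs := (summ_sq (‖a‖ ^ 2) ‖q‖ (by positivity) (norm_nonneg _) hq).mul_of_nonneg
    (summ_sq ‖a‖ ‖q‖ (norm_nonneg _) (norm_nonneg _) hq) (fun _ => by positivity)
    (fun _ => by positivity)
  refine Summable.of_norm_bounded (hs.mul_left C) fun x => ?_
  have hC0 : 0 ≤ C := (norm_nonneg _).trans (hC x)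
  rw [hfg, norm_mul, norm_mul, norm_pow, norm_pow]
  have h3 : ‖q‖ ^ e x ≤ ‖q‖ ^ (x.1 ^ 2 + x.2 ^ 2) :=
    pow_le_pow_of_le_one (norm_nonneg _) hq.le (he x)
  calc ‖g x‖ * (‖a‖ ^ (2 * x.1 + x.2) * ‖q‖ ^ e x)
      ≤ C * (‖a‖ ^ (2 * x.1 + x.2) * ‖q‖ ^ (x.1 ^ 2 + x.2 ^ 2)) := by
        gcongr
        exact hC x
    _ = _ := by ring

/-- Identity (3.27) of the paper. -/
theorem twee_identity (q a : ℂ) (hq : ‖q‖ < 1)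
    (ha : ∀ m : ℕ, 1 ≤ m → a * q ^ m ≠ 1) :
    (∑' x : ℕ × ℕ,
      a ^ (2 * x.1 + x.2) * q ^ (x.1 * (2 * x.1 + 2 * x.2 + 1) + x.2 ^ 2 + x.2) *
        qBinTop q ((x.2 : ℤ) + 1) x.1 /
        (qP q (a * q) (2 * x.1 + 2 * x.2 + 1) * qP q q x.2))
    = (qPInf q (a * q))⁻¹ *
        ∑' i : ℕ, a ^ (2 * i) * q ^ (i * (2 * i + 1)) / qP q q i := by
  have hb : ∀ m : ℕ, a * q * q ^ m ≠ 1 := fun m => by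
    rw [mul_assoc, ← pow_succ']; exact ha _ (by omega)
  have hne := qP_ne q q (qq_ne q hq)
  have hnb := qP_ne q (a * q) hb
  obtain ⟨C1, h1, hC1⟩ := qP_inv_bdd q q hq (qq_ne q hq)
  obtain ⟨C2, h2, hC2⟩ := qP_inv_bdd q (a * q) hq hb
  obtain ⟨C3, h3, hC3⟩ := tendsto_bdd _ _ (qP_tendsto q q hq)
  have hbin : ∀ j k : ℕ, qBinTop q ((k : ℤ) + 1) j = qP q (q ^ (k + 2)) j / qP q q j := by
    intro j k
    rw [qBinTop]
    congr 2
  have hnum : ∀ j k : ℕ, qP q (q ^ (k + 2)) j = qP q q (k + 1 + j) * (qP q q (k + 1))⁻¹ := by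
    intro j k
    have := hne (k + 1)
    rw [qP_add, ← pow_succ']
    field_simp
  set T : ℕ × ℕ → ℂ := fun x =>
      a ^ (2 * x.1 + x.2) * q ^ (x.1 * (2 * x.1 + 2 * x.2 + 1) + x.2 ^ 2 + x.2) *
        qBinTop q ((x.2 : ℤ) + 1) x.1 /
        (qP q (a * q) (2 * x.1 + 2 * x.2 + 1) * qP q q x.2) with hT
  set U : ℕ × ℕ → ℂ := fun x =>
      a ^ (2 * x.1 + x.2) * q ^ (x.1 * (2 * x.1 + 2 * x.2 + 1) + x.2 ^ 2 + x.2) /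
        (qP q q x.1 * qP q q x.2 * qP q (a * q) (2 * x.1 + 1 + x.2)) with hU
  have he : ∀ x : ℕ × ℕ, x.1 ^ 2 + x.2 ^ 2 ≤
      x.1 * (2 * x.1 + 2 * x.2 + 1) + x.2 ^ 2 + x.2 := by
    intro x; nlinarith [Nat.zero_le (x.1 * x.2), Nat.zero_le (x.1 ^ 2)]
  have hTs : Summable T := by
    refine summ_prod q a hq T (fun x => qP q q (x.2 + 1 + x.1) * (qP q q (x.2 + 1))⁻¹ *
      (qP q q x.1)⁻¹ * (qP q (a * q) (2 * x.1 + 2 * x.2 + 1))⁻¹ * (qP q q x.2)⁻¹)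
      (C3 * C1 * C1 * C2 * C1) ?_ _ he ?_
    · exact bdd_mul _ _ _ _ (bdd_mul _ _ _ _ (bdd_mul _ _ _ _ (bdd_mul _ _ _ _
        (fun x => hC3 _) (fun x => hC1 _)) (fun x => hC1 _)) (fun x => hC2 _)) (fun x => hC1 _)
    · intro x
      simp only [hT, hbin, hnum, div_eq_mul_inv, mul_inv]
      ring
  have hUs : Summable U := by
    refine summ_prod q a hq U (fun x => 
      (qP q q x.1)⁻¹ * (qP q q x.2)⁻¹ * (qP q (a * q) (2 * x.1 + 1 + x.2))⁻¹)
      (C1 * C1 * C2) ?_ _ he ?_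
    · exact bdd_mul _ _ _ _ (bdd_mul _ _ _ _
        (fun x => hC1 _) (fun x => hC1 _)) (fun x => hC2 _)
    · intro x
      simp only [hU, div_eq_mul_inv, mul_inv]
      ring
  have hTU : ∀ s, ∑ p ∈ HasAntidiagonal.antidiagonal s, T p = ∑ p ∈ HasAntidiagonal.antidiagonal s, U p := by
    intro s
    have h := congrArg (fun z => a ^ s * q ^ (s ^ 2 + s) / qP q (a * q) (2 * s + 1) * z)
      (bailey_fin q hq a s)
    simp only [Finset.mul_sum] at h
    refine (Finset.sum_congr rfl fun p hp => ?_).trans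
      (h.trans (Finset.sum_congr rfl fun p hp => ?_))
    · have hs := HasAntidiagonal.mem_antidiagonal.mp hp
      subst hs
      simp only [hT, hbin]
      rw [show 2 * (p.1 + p.2) + 1 = 2 * p.1 + 2 * p.2 + 1 by ring]
      simp only [div_eq_mul_inv, mul_inv]
      ring
    · have hs := HasAntidiagonal.mem_antidiagonal.mp hp
      subst hs
      have hsplit : qP q (a * q) (2 * (p.1 + p.2) + 1) =
          qP q (a * q) (2 * p.1 + 1 + p.2) * qP q (a * q ^ (p.1 + p.2 + p.1 + 2)) p.2 := by
        rw [show 2 * (p.1 + p.2) + 1 = 2 * p.1 + 1 + p.2 + p.2 by ring, qP_add]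
        congr 2
        ring
      have hX : qP q (a * q ^ (p.1 + p.2 + p.1 + 2)) p.2 ≠ 0 := by
        intro h0
        rw [h0, mul_zero] at hsplit
        exact hnb _ hsplit
      simp only [hU]
      rw [hsplit]
      have := hne p.1
      have := hne p.2
      have := hnb (2 * p.1 + 1 + p.2)
      field_simp
      ring
  rw [tsum_antidiag T hTs, tsum_congr hTU, ← tsum_antidiag U hUs, hUs.tsum_prod, ← tsum_mul_left]
  refine tsum_congr fun i => ?_
  rw [← cau_sum q a hq hb (2 * i + 1), mul_comm, ← tsum_mul_left]
  refine tsum_congr fun r => ?_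
  simp only [hU, cau, div_eq_mul_inv, mul_inv]
  ring
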